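/- arXiv:2112.10868 — 2 statements merged into one kernel-verified Lean document; each statement's English description precedes it below -/
import Mathlib

section
/- Under the stated block hypotheses, for every pair i ≠ j in {0,…,d−1} one has F_{ij} (F_{ij})† = (4/d²) sin²(π/m) · 1_D, where † denotes the conjugate transpose and 1_D the D×D identity. -/
open Matrix Kronecker

/-- `omg d t` is ω^t = exp(2πi·t/d), where ω = exp(2πi/d). -/
noncomputable def omg (d : ℕ) (t : ℝ) : ℂ :=
  Complex.exp ((2 * Real.pi * t / d : ℝ) * Complex.I)

/-- The coefficient a_k = ω^{(2k−d)/(4m)} / (2 cos(π/(2m))). -/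
noncomputable def acoef (d m k : ℕ) : ℂ :=
  omg d ((2 * (k : ℝ) - d) / (4 * m)) / ((2 * Real.cos (Real.pi / (2 * m)) : ℝ) : ℂ)

/-- `abar d m A B k` is Ābar^{(k)} = a_k A^k + conj(a_k) B^k. -/
noncomputable def abar {n : Type*} [Fintype n] [DecidableEq n] (d m : ℕ)
    (A B : Matrix n n ℂ) (k : ℕ) : Matrix n n ℂ :=
  acoef d m k • A ^ k + (starRingEnd ℂ) (acoef d m k) • B ^ k

/-- Z_d = diag(1, ω, …, ω^{d−1}). -/
noncomputable def Zmat (d : ℕ) : Matrix (Fin d) (Fin d) ℂ :=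
  Matrix.diagonal fun i => omg d (i : ℝ)

/-- If `C_k = t A^k + (1 - t) B^k` satisfies `C_1 C_k = C_{k+1}`, then `(A - B) (A^k - B^k) = 0`. -/
lemma sub_mul_pow_sub_pow_eq_zero {R : Type*} [Ring R] [Algebra ℂ R] (A B : R) (t : ℂ)
    (ht : t ≠ 0) (ht' : 1 - t ≠ 0) (k : ℕ)
    (h : (t • A + (1 - t) • B) * (t • A ^ k + (1 - t) • B ^ k)
      = t • A ^ (k + 1) + (1 - t) • B ^ (k + 1)) :
    (A - B) * (A ^ k - B ^ k) = 0 := by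
  have key : (t * (1 - t)) • ((A - B) * (A ^ k - B ^ k))
      = (t • A ^ (k + 1) + (1 - t) • B ^ (k + 1))
        - (t • A + (1 - t) • B) * (t • A ^ k + (1 - t) • B ^ k) := by
    simp only [add_mul, mul_add, sub_mul, mul_sub, smul_mul_assoc, mul_smul_comm, ← pow_succ']
    module
  rw [h, sub_self] at key
  exact (smul_eq_zero.mp key).resolve_left (mul_ne_zero ht ht')

lemma sum_pow_mul_sub_mul_pow {R : Type*} [Ring R] (A B : R) (n : ℕ) :
    ∑ j ∈ Finset.range n, A ^ j * (A - B) * B ^ (n - 1 - j) = A ^ n - B ^ n := by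
  have := Finset.sum_range_sub (fun j => A ^ j * B ^ (n - j)) n
  simp only [Nat.sub_self, pow_zero, mul_one, one_mul, Nat.sub_zero] at this
  rw [← this]
  refine Finset.sum_congr rfl fun j hj => ?_
  have hj' := Finset.mem_range.mp hj
  rw [show n - j = (n - 1 - j) + 1 by omega, show n - (j + 1) = n - 1 - j by omega,
    pow_succ A, pow_succ' B]
  noncomm_ring

/-- The `(i, j)` block of a block matrix. -/
def blockAt {d D : ℕ} (M : Matrix (Fin d × Fin D) (Fin d × Fin D) ℂ) (i j : Fin d) :
    Matrix (Fin D) (Fin D) ℂ :=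
  Matrix.of fun p q => M (i, p) (j, q)

/-- The block-diagonal matrix with scalar blocks `u i`. -/
def blockScalar {d : ℕ} (D : ℕ) (u : Fin d → ℂ) :
    Matrix (Fin d × Fin D) (Fin d × Fin D) ℂ :=
  Matrix.diagonal fun p => u p.1

section Blocks

variable {d D : ℕ} (M N : Matrix (Fin d × Fin D) (Fin d × Fin D) ℂ) (u : Fin d → ℂ) (i j : Fin d)

lemma blockAt_mul : blockAt (M * N) i j = ∑ l, blockAt M i l * blockAt N l j := by
  ext p q
  simp [blockAt, Matrix.mul_apply, Matrix.sum_apply, Fintype.sum_prod_type]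

lemma blockAt_sum {ι : Type*} (s : Finset ι)
    (f : ι → Matrix (Fin d × Fin D) (Fin d × Fin D) ℂ) :
    blockAt (∑ k ∈ s, f k) i j = ∑ k ∈ s, blockAt (f k) i j := by
  ext p q
  simp [blockAt, Matrix.sum_apply]

lemma blockAt_add : blockAt (M + N) i j = blockAt M i j + blockAt N i j := rfl

lemma blockAt_smul (c : ℂ) : blockAt (c • M) i j = c • blockAt M i j := rfl

lemma blockAt_zero : blockAt (0 : Matrix (Fin d × Fin D) (Fin d × Fin D) ℂ) i j = 0 := rfl

lemma blockAt_conjTranspose : blockAt Mᴴ i j = (blockAt M j i)ᴴ := rfl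

lemma blockAt_one_self :
    blockAt (1 : Matrix (Fin d × Fin D) (Fin d × Fin D) ℂ) i i = 1 := by
  ext p q
  simp [blockAt, Matrix.one_apply]

lemma blockAt_blockScalar_mul : blockAt (blockScalar D u * M) i j = u i • blockAt M i j := by
  ext p q
  simp [blockAt, blockScalar]

lemma blockAt_mul_blockScalar : blockAt (M * blockScalar D u) i j = u j • blockAt M i j := by
  ext p q
  simp [blockAt, blockScalar, mul_comm]

lemma blockScalar_pow (k : ℕ) : blockScalar D u ^ k = blockScalar D (u ^ k) := by
  simp only [blockScalar, Matrix.diagonal_pow]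
  rfl

lemma blockScalar_conjTranspose : (blockScalar D u)ᴴ = blockScalar D (star u) := by
  simp only [blockScalar, Matrix.diagonal_conjTranspose]
  rfl

lemma blockScalar_const (c : ℂ) (hu : ∀ i, u i = c) : blockScalar D u = c • 1 := by
  rw [blockScalar, Matrix.smul_one_eq_diagonal]
  simp [hu]

end Blocks

/-- A family whose Fourier coefficients vanish at `0, …, d - 2` is proportional to `w ^ l`. -/
lemma eq_smul_of_fourier_vanish {V : Type*} [AddCommGroup V] [Module ℂ V] {d : ℕ} {w : ℂ}
    (hd : d ≠ 0) (hw : IsPrimitiveRoot w d) (v : Fin d → V)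
    (h : ∀ j, j + 2 ≤ d → ∑ l : Fin d, (w ^ (l : ℕ)) ^ j • v l = 0) (l : Fin d) :
    v l = w ^ (l : ℕ) • ((d : ℂ)⁻¹ • ∑ l : Fin d, (w ^ (l : ℕ)) ^ (d - 1) • v l) := by
  have hd' : (d : ℂ) ≠ 0 := Nat.cast_ne_zero.mpr hd
  have hw0 : w ≠ 0 := hw.ne_zero hd
  have orth : ∀ a : Fin d, ∑ j ∈ Finset.range d, (w ^ (l : ℕ))⁻¹ ^ j * (w ^ (a : ℕ)) ^ j
      = if a = l then (d : ℂ) else 0 := by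
    intro a
    simp only [← mul_pow]
    split_ifs with hal
    · subst hal
      simp [inv_mul_cancel₀ (pow_ne_zero (a : ℕ) hw0)]
    · have h1 : (w ^ (l : ℕ))⁻¹ * w ^ (a : ℕ) ≠ 1 := by
        intro hh
        rw [inv_mul_eq_one₀ (pow_ne_zero _ hw0)] at hh
        exact hal (Fin.ext (hw.pow_inj l.2 a.2 hh).symm)
      have hp : ((w ^ (l : ℕ))⁻¹ * w ^ (a : ℕ)) ^ d = 1 := by
        rw [mul_pow, inv_pow, ← pow_mul, ← pow_mul, mul_comm _ d, mul_comm _ d, pow_mul, pow_mul,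
          hw.pow_eq_one]
        simp
      rw [geom_sum_eq h1, hp, sub_self, zero_div]
  have e1 : ∑ j ∈ Finset.range d, (w ^ (l : ℕ))⁻¹ ^ j • ∑ a : Fin d, (w ^ (a : ℕ)) ^ j • v a
      = (d : ℂ) • v l := by
    simp only [Finset.smul_sum, smul_smul]
    rw [Finset.sum_comm]
    simp only [← Finset.sum_smul, orth]
    simp
  have e2 : ∑ j ∈ Finset.range d, (w ^ (l : ℕ))⁻¹ ^ j • ∑ a : Fin d, (w ^ (a : ℕ)) ^ j • v a
      = (w ^ (l : ℕ))⁻¹ ^ (d - 1) • ∑ a : Fin d, (w ^ (a : ℕ)) ^ (d - 1) • v a := by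
    refine Finset.sum_eq_single_of_mem (d - 1) (Finset.mem_range.mpr (by omega)) ?_
    intro j hj hne
    have := Finset.mem_range.mp hj
    rw [h j (by omega), smul_zero]
  have e3 : (w ^ (l : ℕ))⁻¹ ^ (d - 1) = w ^ (l : ℕ) := by
    have h1 : (w ^ (l : ℕ)) ^ (d - 1) * w ^ (l : ℕ) = 1 := by
      rw [← pow_succ, Nat.sub_add_cancel (by omega), ← pow_mul, mul_comm, pow_mul, hw.pow_eq_one,
        one_pow]
    rw [inv_pow]
    exact inv_eq_of_mul_eq_one_right h1
  rw [smul_comm, ← e3, ← e2, e1, smul_smul, inv_mul_cancel₀ hd', one_smul]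

lemma blockAt_mul_blockAt_swap {d D : ℕ} (hd : d ≠ 0) {w x c : ℂ} (hx : x ≠ 0)
    (hw : IsPrimitiveRoot w d) (N : Matrix (Fin d × Fin D) (Fin d × Fin D) ℂ)
    (h1 : ∀ k, k + 2 ≤ d → N * blockScalar D (fun i : Fin d => x * w ^ (i : ℕ)) ^ k * N = 0)
    (h2 : ∑ k ∈ Finset.range d, blockScalar D (fun i : Fin d => x * w ^ (i : ℕ)) ^ k * N *
      blockScalar D (fun i : Fin d => x * w ^ (i : ℕ)) ^ (d - 1 - k) = c • 1)
    (i j : Fin d) :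
    blockAt N i j * blockAt N j i
      = (c ^ 2 * x ^ 2 * w ^ (i : ℕ) * w ^ (j : ℕ) / (d * x ^ d) ^ 2) •
        (1 : Matrix (Fin D) (Fin D) ℂ) := by
  have hd' : (d : ℂ) ≠ 0 := Nat.cast_ne_zero.mpr hd
  have hw0 : w ≠ 0 := hw.ne_zero hd
  have hdiag : blockAt N i i = (c * (x * w ^ (i : ℕ)) / (d * x ^ d)) • 1 := by
    have h := congrArg (fun M => blockAt M i i) h2
    simp only [blockAt_sum, blockAt_smul, blockAt_one_self, blockScalar_pow,
      blockAt_blockScalar_mul, blockAt_mul_blockScalar, Pi.pow_apply, smul_smul,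
      ← Finset.sum_smul, ← pow_add] at h
    have hs : ∑ k ∈ Finset.range d, (x * w ^ (i : ℕ)) ^ (d - 1 - k + k)
        = d * (x * w ^ (i : ℕ)) ^ (d - 1) := by
      rw [Finset.sum_congr rfl (g := fun _ => (x * w ^ (i : ℕ)) ^ (d - 1))]
      · simp
      · intro k hk
        have := Finset.mem_range.mp hk
        congr 1
        omega
    have hp : (x * w ^ (i : ℕ)) ^ (d - 1) * (x * w ^ (i : ℕ)) = x ^ d := by
      rw [← pow_succ, Nat.sub_add_cancel (by omega), mul_pow, ← pow_mul, mul_comm _ d, pow_mul,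
        hw.pow_eq_one, one_pow, mul_one]
    have hμ : x * w ^ (i : ℕ) ≠ 0 := mul_ne_zero hx (pow_ne_zero _ hw0)
    rw [hs] at h
    have h' := congrArg (fun M => ((x * w ^ (i : ℕ)) / (d * x ^ d)) • M) h
    simp only [smul_smul] at h'
    rw [show (x * w ^ (i : ℕ)) / (d * x ^ d) * (d * (x * w ^ (i : ℕ)) ^ (d - 1)) = 1 by
      rw [← hp]; field_simp, one_smul] at h'
    rw [h']
    congr 1
    ring
  have hF := eq_smul_of_fourier_vanish hd hw (fun l => blockAt N i l * blockAt N l i) (by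
    intro k hk
    have h := congrArg (fun M => blockAt M i i) (h1 k hk)
    simp only [blockAt_mul _ N, blockAt_zero, blockScalar_pow, blockAt_mul_blockScalar,
      Pi.pow_apply, smul_mul_assoc, mul_pow x, mul_smul, ← Finset.smul_sum] at h
    exact (smul_eq_zero.mp h).resolve_left (pow_ne_zero _ hx))
  have hi := hF i
  have hj := hF j
  have hwi := pow_ne_zero (i : ℕ) hw0
  set W := (d : ℂ)⁻¹ • ∑ l : Fin d, (w ^ (l : ℕ)) ^ (d - 1) • (blockAt N i l * blockAt N l i)
  have hW : W = (w ^ (i : ℕ))⁻¹ • (blockAt N i i * blockAt N i i) := by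
    rw [hi, smul_smul, inv_mul_cancel₀ hwi, one_smul]
  rw [hj, hW, hdiag]
  simp only [mul_smul_comm, smul_smul, mul_one]
  congr 1
  field_simp

/-- The off-diagonal blocks of `A - B` have `N N† = -(s - s⁻¹)² / d²`, where `s = A^d = (B^d)⁻¹`. -/
lemma blockAt_mul_conjTranspose {d D : ℕ} (hd : d ≠ 0) {w x : ℂ} (hx : star x * x = 1)
    (hw : IsPrimitiveRoot w d) (hww : star w * w = 1)
    (A B : Matrix (Fin d × Fin D) (Fin d × Fin D) ℂ)
    (hA : A = blockScalar D fun i : Fin d => x * w ^ (i : ℕ))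
    (hB : Bᴴ * B = 1) (hBd : B ^ d = (x ^ d)⁻¹ • 1)
    (h : ∀ k, 1 ≤ k → k + 1 ≤ d → (A - B) * (A ^ k - B ^ k) = 0) (hd2 : 2 ≤ d) (i j : Fin d) :
    blockAt (A - B) i j * (blockAt (A - B) i j)ᴴ
      = (-(x ^ d - (x ^ d)⁻¹) ^ 2 / d ^ 2) • (1 : Matrix (Fin D) (Fin D) ℂ) := by
  have hx0 : x ≠ 0 := right_ne_zero_of_mul_eq_one hx
  have hw0 : w ≠ 0 := hw.ne_zero hd
  have hd' : (d : ℂ) ≠ 0 := Nat.cast_ne_zero.mpr hd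
  have hpow : ∀ k, k + 1 ≤ d → (A - B) * A ^ k = (A - B) * B ^ k := by
    intro k hk
    rcases Nat.eq_zero_or_pos k with rfl | hk0
    · simp
    · exact sub_eq_zero.mp (by rw [← mul_sub]; exact h k hk0 hk)
  have hAd : A ^ d = (x ^ d) • 1 := by
    rw [hA, blockScalar_pow]
    refine blockScalar_const _ _ fun l => ?_
    rw [Pi.pow_apply, mul_pow, ← pow_mul, mul_comm _ d, pow_mul, hw.pow_eq_one, one_pow, mul_one]
  have hAA : Aᴴ * A = 1 := by
    rw [hA, blockScalar_conjTranspose, blockScalar, blockScalar, Matrix.diagonal_mul_diagonal,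
      ← Matrix.diagonal_one]
    congr 1
    funext l
    have : star (w ^ (l.1 : ℕ)) * w ^ (l.1 : ℕ) = 1 := by
      rw [star_pow, ← mul_pow, hww, one_pow]
    simp only [Pi.star_apply, star_mul]
    linear_combination (star (w ^ (l.1 : ℕ)) * w ^ (l.1 : ℕ)) * hx + this
  have hvan : ∀ k, k + 2 ≤ d → (A - B) * A ^ k * (A - B) = 0 := by
    intro k hk
    have h1 := hpow k (by omega)
    have h2 := hpow (k + 1) (by omega)
    rw [mul_sub, mul_assoc, ← pow_succ, h2, h1, mul_assoc, ← pow_succ, sub_self]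
  have hsum : ∑ k ∈ Finset.range d, A ^ k * (A - B) * A ^ (d - 1 - k)
      = (x ^ d - (x ^ d)⁻¹) • 1 := by
    rw [sub_smul, ← hAd, ← hBd, ← sum_pow_mul_sub_mul_pow]
    refine Finset.sum_congr rfl fun k hk => ?_
    have := Finset.mem_range.mp hk
    rw [mul_assoc, hpow _ (by omega), ← mul_assoc]
  have hswap := blockAt_mul_blockAt_swap hd hx0 hw (A - B)
    (by rw [← hA]; exact hvan) (by rw [← hA]; exact hsum) i j
  have hBB : B * Bᴴ = 1 := mul_eq_one_comm.mp hB
  have hAA' : A * Aᴴ = 1 := mul_eq_one_comm.mp hAA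
  have hA1 : A ^ (d - 1) = (x ^ d) • Aᴴ := by
    calc A ^ (d - 1) = A ^ (d - 1) * (A * Aᴴ) := by rw [hAA', mul_one]
      _ = A ^ d * Aᴴ := by rw [← mul_assoc, ← pow_succ, Nat.sub_add_cancel (by omega)]
      _ = _ := by rw [hAd, smul_mul_assoc, one_mul]
  have hB1 : B ^ (d - 1) = (x ^ d)⁻¹ • Bᴴ := by
    calc B ^ (d - 1) = B ^ (d - 1) * (B * Bᴴ) := by rw [hBB, mul_one]
      _ = B ^ d * Bᴴ := by rw [← mul_assoc, ← pow_succ, Nat.sub_add_cancel (by omega)]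
      _ = _ := by rw [hBd, smul_mul_assoc, one_mul]
  have hN : (x ^ d) • ((A - B) * Aᴴ) + (x ^ d)⁻¹ • (A * (A - B)ᴴ) = 0 := by
    have h1 := hpow (d - 1) (by omega)
    rw [hA1, hB1, mul_smul_comm, mul_smul_comm] at h1
    rw [h1, ← smul_add, Matrix.conjTranspose_sub, sub_mul, mul_sub, hBB, hAA']
    simp
  have hblk := congrArg (fun M => blockAt M j i) hN
  simp only [blockAt_add, blockAt_smul, blockAt_zero] at hblk
  rw [hA, blockScalar_conjTranspose, blockAt_mul_blockScalar, blockAt_blockScalar_mul, ← hA,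
    blockAt_conjTranspose, smul_smul, smul_smul] at hblk
  have hstar : star (x * w ^ (i : ℕ)) = (x * w ^ (i : ℕ))⁻¹ := by
    have : star (w ^ (i : ℕ)) * w ^ (i : ℕ) = 1 := by
      rw [star_pow, ← mul_pow, hww, one_pow]
    refine eq_inv_of_mul_eq_one_left ?_
    rw [star_mul]
    linear_combination (star (w ^ (i : ℕ)) * w ^ (i : ℕ)) * hx + this
  have hx' := pow_ne_zero d hx0
  have hwi := pow_ne_zero (i : ℕ) hw0
  have hwj := pow_ne_zero (j : ℕ) hw0
  have hadj : (blockAt (A - B) i j)ᴴ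
      = (-(x ^ d) ^ 2 / (x ^ 2 * w ^ (i : ℕ) * w ^ (j : ℕ))) • blockAt (A - B) j i := by
    have h3 := eq_neg_of_add_eq_zero_right hblk
    have h4 := congrArg (fun M => (x ^ d / (x * w ^ (j : ℕ))) • M) h3
    simp only [smul_smul, ← neg_smul] at h4
    rw [show x ^ d / (x * w ^ (j : ℕ)) * ((x ^ d)⁻¹ * (x * w ^ (j : ℕ))) = 1 by field_simp,
      one_smul] at h4
    rw [h4, Pi.star_apply, hstar]
    congr 1
    field_simp
  rw [hadj, mul_smul_comm, hswap, smul_smul]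
  congr 1
  field_simp

lemma acoef_eq {d m : ℕ} (hd : d ≠ 0) (hm : m ≠ 0) (k : ℕ) :
    acoef d m k = Complex.exp (-((Real.pi / (2 * m) : ℝ) * Complex.I)) /
      ((2 * Real.cos (Real.pi / (2 * m)) : ℝ) : ℂ) *
      Complex.exp ((Real.pi / (d * m) : ℝ) * Complex.I) ^ k := by
  have hd' : (d : ℂ) ≠ 0 := Nat.cast_ne_zero.mpr hd
  have hm' : (m : ℂ) ≠ 0 := Nat.cast_ne_zero.mpr hm
  rw [acoef, omg, div_mul_eq_mul_div, ← Complex.exp_nat_mul, ← Complex.exp_add]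
  congr 2
  push_cast
  field_simp
  ring

lemma zmat_kronecker_one (d D : ℕ) :
    Zmat d ⊗ₖ (1 : Matrix (Fin D) (Fin D) ℂ) = blockScalar D fun i : Fin d => omg d 1 ^ (i : ℕ) := by
  rw [Zmat, ← Matrix.diagonal_one, Matrix.diagonal_kronecker_diagonal, blockScalar]
  congr 1
  funext p
  rw [mul_one, omg, omg, ← Complex.exp_nat_mul]
  congr 1
  push_cast
  ring

lemma star_exp_mul_I_mul_self (θ : ℝ) :
    star (Complex.exp (θ * Complex.I)) * Complex.exp (θ * Complex.I) = 1 := by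
  rw [Complex.star_def, ← Complex.exp_conj, ← Complex.exp_add]
  simp

/-- For i ≠ j, F_{ij} (F_{ij})† = (4/d²) sin²(π/m) · 1_D. -/
theorem stmt10 (d m D : ℕ) (hd : 2 ≤ d) (hm : 2 ≤ m) (hD : 1 ≤ D)
    (B : Matrix (Fin d × Fin D) (Fin d × Fin D) ℂ)
    (hB : B ∈ Matrix.unitaryGroup (Fin d × Fin D) ℂ) (hBd : B ^ d = 1)
    (F : Fin d → Fin d → Matrix (Fin D) (Fin D) ℂ)
    (hF : ∀ (i j : Fin d) (p q : Fin D), B (i, p) (j, q) = F i j p q)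
    (hrel1 : ∀ k, 1 ≤ k → k ≤ d - 1 →
      abar d m (Zmat d ⊗ₖ (1 : Matrix (Fin D) (Fin D) ℂ)) B k *
        abar d m (Zmat d ⊗ₖ (1 : Matrix (Fin D) (Fin D) ℂ)) B (d - k) = 1)
    (hrel2 : ∀ k, 1 ≤ k → k ≤ d - 1 →
      abar d m (Zmat d ⊗ₖ (1 : Matrix (Fin D) (Fin D) ℂ)) B k =
        (abar d m (Zmat d ⊗ₖ (1 : Matrix (Fin D) (Fin D) ℂ)) B 1) ^ k) :
    ∀ i j : Fin d, i ≠ j →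
      F i j * (F i j)ᴴ =
        ((4 / (d : ℂ) ^ 2) * (Real.sin (Real.pi / m) : ℂ) ^ 2) •
          (1 : Matrix (Fin D) (Fin D) ℂ) := by
  have hd0 : d ≠ 0 := by omega
  have hm0 : m ≠ 0 := by omega
  have hd' : (d : ℂ) ≠ 0 := Nat.cast_ne_zero.mpr hd0
  have hm' : (m : ℂ) ≠ 0 := Nat.cast_ne_zero.mpr hm0
  set A := Zmat d ⊗ₖ (1 : Matrix (Fin D) (Fin D) ℂ) with hAdef
  set w := omg d 1 with hw
  set x := Complex.exp ((Real.pi / (d * m) : ℝ) * Complex.I) with hx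
  set e := Complex.exp ((Real.pi / (2 * m) : ℝ) * Complex.I) with he
  set K := ((2 * Real.cos (Real.pi / (2 * m)) : ℝ) : ℂ) with hK
  have hx0 : x ≠ 0 := Complex.exp_ne_zero _
  have he0 : e ≠ 0 := Complex.exp_ne_zero _
  have hxx : star x * x = 1 := star_exp_mul_I_mul_self _
  have hxx' : star x = x⁻¹ := eq_inv_of_mul_eq_one_left hxx
  have hee : star e = e⁻¹ := eq_inv_of_mul_eq_one_left (star_exp_mul_I_mul_self _)
  have hww : star w * w = 1 := star_exp_mul_I_mul_self _
  have hwprim : IsPrimitiveRoot w d := by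
    convert Complex.isPrimitiveRoot_exp d hd0 using 1
    rw [hw, omg]
    congr 1
    push_cast
    ring
  have hxd : x ^ d = e ^ 2 := by
    rw [hx, he, ← Complex.exp_nat_mul, ← Complex.exp_nat_mul]
    congr 1
    push_cast
    field_simp
  have hK2 : K = e + e⁻¹ := by
    rw [hK, he, ← Complex.exp_neg]
    push_cast
    rw [Complex.two_cos, neg_mul]
  have hK0 : K ≠ 0 := by
    rw [hK]
    have hm2 : (2 : ℝ) ≤ m := by exact_mod_cast hm
    have : 0 < Real.cos (Real.pi / (2 * m)) := by
      apply Real.cos_pos_of_mem_Ioo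
      constructor
      · have : 0 < Real.pi / (2 * m) := by positivity
        linarith [Real.pi_pos]
      · rw [div_lt_div_iff₀ (by positivity) (by positivity)]
        nlinarith [Real.pi_pos]
    exact_mod_cast (by positivity : 2 * Real.cos (Real.pi / (2 * m)) ≠ 0)
  have hKs : star K = K := Complex.conj_ofReal _
  have hac : ∀ k, acoef d m k = e⁻¹ / K * x ^ k := by
    intro k
    rw [acoef_eq hd0 hm0, Complex.exp_neg]
  have ht1 : 1 - e⁻¹ / K = e / K := by
    rw [eq_div_iff hK0, sub_mul, div_mul_cancel₀ _ hK0, hK2]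
    ring
  have hacs : ∀ k, (starRingEnd ℂ) (acoef d m k) = (1 - e⁻¹ / K) * x⁻¹ ^ k := by
    intro k
    rw [hac, ht1, ← Complex.star_def, star_mul, star_div₀, star_inv₀, star_pow, hee, hxx', hKs,
      inv_inv, mul_comm]
  have habar : ∀ k, abar d m A B k
      = (e⁻¹ / K) • (x • A) ^ k + (1 - e⁻¹ / K) • (x⁻¹ • B) ^ k := by
    intro k
    rw [abar, hacs, hac, smul_pow, smul_pow, smul_smul, smul_smul]
  have hA : x • A = blockScalar D fun i : Fin d => x * w ^ (i : ℕ) := by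
    rw [hAdef, zmat_kronecker_one, blockScalar, blockScalar, ← Matrix.diagonal_smul]
    rfl
  have hAd : (x • A) ^ d = (x ^ d) • 1 := by
    rw [hA, blockScalar_pow]
    refine blockScalar_const _ _ fun l => ?_
    rw [Pi.pow_apply, mul_pow, ← pow_mul, mul_comm _ d, pow_mul, hwprim.pow_eq_one, one_pow,
      mul_one]
  have hBd' : (x⁻¹ • B) ^ d = (x ^ d)⁻¹ • 1 := by
    rw [smul_pow, hBd, inv_pow]
  have hBB : (x⁻¹ • B)ᴴ * (x⁻¹ • B) = 1 := by
    have h : Bᴴ * B = 1 := Matrix.mem_unitaryGroup_iff'.mp hB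
    rw [Matrix.conjTranspose_smul, smul_mul_smul_comm, h, star_inv₀, hxx', inv_inv,
      mul_inv_cancel₀ hx0, one_smul]
  have hrel : ∀ k, 1 ≤ k → k + 1 ≤ d →
      (x • A - x⁻¹ • B) * ((x • A) ^ k - (x⁻¹ • B) ^ k) = 0 := by
    intro k hk hkd
    refine sub_mul_pow_sub_pow_eq_zero _ _ (e⁻¹ / K) (div_ne_zero (inv_ne_zero he0) hK0)
      (by rw [ht1]; exact div_ne_zero he0 hK0) k ?_
    have h1 := habar 1
    rw [pow_one, pow_one] at h1
    rw [← h1, ← habar k]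
    rcases Nat.lt_or_ge (k + 1) d with hlt | hge
    · rw [← habar (k + 1), hrel2 k hk (by omega), hrel2 (k + 1) (by omega) (by omega), pow_succ']
    · have hkd' : k + 1 = d := by omega
      rw [hkd', hAd, hBd', hxd, show k = d - 1 by omega, hrel1 1 le_rfl (by omega), smul_smul,
        smul_smul, ← add_smul, ht1,
        show e⁻¹ / K * e ^ 2 + e / K * (e ^ 2)⁻¹ = 1 by
          rw [div_mul_eq_mul_div, div_mul_eq_mul_div, ← add_div, div_eq_one_iff_eq hK0, hK2]
          field_simp,
        one_smul]
  intro i j hij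
  have key := blockAt_mul_conjTranspose hd0 hxx hwprim hww (x • A) (x⁻¹ • B) hA hBB hBd' hrel hd i j
  have hFN : F i j = (-x) • blockAt (x • A - x⁻¹ • B) i j := by
    ext p q
    rw [← hF, hA]
    simp [blockAt, blockScalar, hij, hx0]
  have hsin : x ^ d - (x ^ d)⁻¹ = 2 * Complex.I * Real.sin (Real.pi / m) := by
    have h1 : x ^ d = Complex.exp ((Real.pi / m : ℝ) * Complex.I) := by
      rw [hx, ← Complex.exp_nat_mul]
      congr 1
      push_cast
      field_simp
    rw [h1, ← Complex.exp_neg, Complex.ofReal_sin, Complex.sin, neg_mul]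
    linear_combination (Complex.exp ((Real.pi / m : ℝ) * Complex.I) -
      Complex.exp (-((Real.pi / m : ℝ) * Complex.I))) * Complex.I_mul_I
  rw [hFN, Matrix.conjTranspose_smul, smul_mul_smul_comm, key, hsin, smul_smul, star_neg, hxx']
  congr 1
  field_simp
  rw [Complex.I_sq]
  ring
end

section
/- Under the stated block hypotheses, and assuming additionally that F_{0j} = (2𝕚/d) sin(π/m) ω^{j/2 + (2−d)/(2m)} · 1_D for every j = 1,…,d−1, the following holds for all k, j = 1,…,d−1: Σ_{i=1, i≠j}^{d−1} ((1 − ω^{ki})/(1 − ω^{i})) ω^{i/2} F_{ij} = ((1 − ω^{−d/m})/d) ω^{j/2 + 1/m} ( k + ((1 − ω^{kj})/(1 − ω^{j})) ω^{j} ) · 1_D, where 𝕚 is the imaginary unit and 1_D the D×D identity. -/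
open Matrix Kronecker

theorem omg_add (d : ℕ) (s t : ℝ) : omg d (s + t) = omg d s * omg d t := by
  unfold omg
  rw [← Complex.exp_add]
  congr 1
  push_cast
  ring

theorem omg_zero (d : ℕ) : omg d 0 = 1 := by simp [omg]

theorem omg_ne_zero (d : ℕ) (t : ℝ) : omg d t ≠ 0 := Complex.exp_ne_zero _

theorem omg_neg (d : ℕ) (t : ℝ) : omg d (-t) = (omg d t)⁻¹ := by
  refine eq_inv_of_mul_eq_one_left ?_
  rw [← omg_add, neg_add_cancel, omg_zero]

theorem omg_pow (d n : ℕ) (t : ℝ) : omg d t ^ n = omg d (n * t) := by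
  unfold omg
  rw [← Complex.exp_nat_mul]
  congr 1
  push_cast
  ring

theorem conj_omg (d : ℕ) (t : ℝ) : (starRingEnd ℂ) (omg d t) = omg d (-t) := by
  unfold omg
  rw [← Complex.exp_conj, map_mul, Complex.conj_I, Complex.conj_ofReal]
  congr 1
  push_cast
  ring

theorem omg_one_isPrimitiveRoot {d : ℕ} (hd : d ≠ 0) : IsPrimitiveRoot (omg d 1) d := by
  have h : omg d 1 = Complex.exp (2 * Real.pi * Complex.I / d) := by
    unfold omg
    congr 1
    push_cast
    ring
  exact h ▸ Complex.isPrimitiveRoot_exp d hd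

theorem omg_natCast (d i : ℕ) : omg d i = omg d 1 ^ i := by
  rw [omg_pow, mul_one]

theorem omg_natCast_pow_self {d : ℕ} (hd : d ≠ 0) (i : ℕ) : omg d i ^ d = 1 := by
  rw [omg_natCast, ← pow_mul, mul_comm, pow_mul, (omg_one_isPrimitiveRoot hd).pow_eq_one, one_pow]

theorem Zmat_kronecker_one (d D : ℕ) : Zmat d ⊗ₖ (1 : Matrix (Fin D) (Fin D) ℂ) =
    diagonal fun e : Fin d × Fin D => omg d (e.1 : ℝ) := by
  rw [Zmat, ← diagonal_one, diagonal_kronecker_diagonal]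
  simp only [mul_one]

theorem omg_natCast_ne_one {d i : ℕ} (hi : i ≠ 0) (hid : i < d) : omg d i ≠ 1 := by
  rw [omg_natCast]
  exact (omg_one_isPrimitiveRoot (by omega)).pow_ne_one_of_pos_of_lt hi hid

theorem cos_pi_div_two_mul_pos {m : ℕ} (hm : 2 ≤ m) : 0 < Real.cos (Real.pi / (2 * m)) := by
  have hm' : (2 : ℝ) ≤ m := by exact_mod_cast hm
  apply Real.cos_pos_of_mem_Ioo
  constructor
  · have : 0 < Real.pi / (2 * m) := by positivity
    linarith [Real.pi_pos]
  · apply div_lt_div_of_pos_left Real.pi_pos <;> linarith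

theorem sin_pi_div_pos {m : ℕ} (hm : 2 ≤ m) : 0 < Real.sin (Real.pi / m) := by
  have hm' : (2 : ℝ) ≤ m := by exact_mod_cast hm
  apply Real.sin_pos_of_pos_of_lt_pi
  · positivity
  · exact div_lt_self Real.pi_pos (by linarith)

/-- The half-angle normalisation `c = 1 / (2 cos (π / (2m)))` of the coefficients `a_k`. -/
noncomputable def halfSec (m : ℕ) : ℂ := (((2 * Real.cos (Real.pi / (2 * m)) : ℝ)) : ℂ)⁻¹

theorem halfSec_ne_zero {m : ℕ} (hm : 2 ≤ m) : halfSec m ≠ 0 := by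
  have := cos_pi_div_two_mul_pos hm
  unfold halfSec
  apply inv_ne_zero
  exact_mod_cast (by positivity : (2 * Real.cos (Real.pi / (2 * m)) : ℝ) ≠ 0)

theorem halfSec_mul_omg_add {d m : ℕ} (hd : d ≠ 0) (hm : 2 ≤ m) :
    halfSec m * (omg d (-(d / (4 * m))) + omg d (d / (4 * m))) = 1 := by
  have h : omg d (-(d / (4 * m))) + omg d (d / (4 * m))
      = (((2 * Real.cos (Real.pi / (2 * m)) : ℝ)) : ℂ) := by
    have hd' : (d : ℂ) ≠ 0 := by exact_mod_cast hd
    have hm' : (m : ℂ) ≠ 0 := by exact_mod_cast (by omega : m ≠ 0)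
    push_cast
    rw [Complex.two_cos, add_comm]
    unfold omg
    congr 2 <;> · push_cast; field_simp; try ring
  have h0 := halfSec_ne_zero hm
  rw [h]
  unfold halfSec at h0 ⊢
  exact inv_mul_cancel₀ fun h1 => h0 (by rw [h1, _root_.inv_zero])

theorem acoef_eq_s11 (d m k : ℕ) :
    acoef d m k = halfSec m * omg d ((2 * (k : ℝ) - d) / (4 * m)) := by
  rw [acoef, halfSec, div_eq_mul_inv, mul_comm]

theorem conj_acoef (d m k : ℕ) : (starRingEnd ℂ) (acoef d m k) =
    halfSec m * omg d (-((2 * (k : ℝ) - d) / (4 * m))) := by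
  rw [acoef_eq_s11, map_mul, conj_omg, halfSec, ← Complex.ofReal_inv, Complex.conj_ofReal]

section

variable {n : Type*} [Fintype n] [DecidableEq n]

theorem abar_zero {d m : ℕ} (hd : d ≠ 0) (hm : 2 ≤ m) (A B : Matrix n n ℂ) :
    abar d m A B 0 = 1 := by
  rw [abar, pow_zero, pow_zero, ← add_smul, conj_acoef, acoef_eq_s11, ← mul_add]
  convert one_smul ℂ _
  rw [← halfSec_mul_omg_add hd hm]
  congr 3 <;> · push_cast; ring

theorem abar_self {d m : ℕ} (hd : d ≠ 0) (hm : 2 ≤ m) {A B : Matrix n n ℂ}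
    (hA : A ^ d = 1) (hB : B ^ d = 1) : abar d m A B d = 1 := by
  rw [abar, hA, hB, ← add_smul, conj_acoef, acoef_eq_s11, ← mul_add, add_comm (omg _ _)]
  convert one_smul ℂ _
  rw [← halfSec_mul_omg_add hd hm]
  congr 3 <;> ring

/-- The multiplicativity relation for consecutive `abar`s, solved for `B ^ (k + 1)`. -/
theorem pow_succ_of_abar_succ {d m : ℕ} (hd : d ≠ 0) (hm : 2 ≤ m) {A B : Matrix n n ℂ} {k : ℕ}
    (h : abar d m A B (k + 1) = abar d m A B 1 * abar d m A B k) :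
    B ^ (k + 1) = omg d (1 / m) • (A * B ^ k)
      + omg d (1 / m) ^ k • ((B - omg d (1 / m) • A) * A ^ k) := by
  have hm0 : (m : ℝ) ≠ 0 := by exact_mod_cast (by omega : m ≠ 0)
  set c := halfSec m with hc
  set γ := c ^ 2 * omg d (-((k + 1) / (2 * m))) with hγ
  have hγ0 : γ ≠ 0 := mul_ne_zero (pow_ne_zero _ (halfSec_ne_zero hm)) (omg_ne_zero _ _)
  have hcc : c = c ^ 2 * (omg d (-(d / (4 * m))) + omg d (d / (4 * m))) := by
    linear_combination (-c) * halfSec_mul_omg_add hd hm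
  have expand : ∀ x s t : ℝ, x = s + t → omg d x = omg d s * omg d t := by
    rintro x s t rfl
    exact omg_add d s t
  have e1 : acoef d m 1 * (starRingEnd ℂ) (acoef d m k) = γ * omg d (1 / m) := by
    rw [conj_acoef, acoef_eq_s11, ← hc, hγ, mul_mul_mul_comm, ← omg_add, mul_assoc (c ^ 2), ← omg_add, sq]
    congr 2
    push_cast
    field_simp
    ring
  have e2 : (starRingEnd ℂ) (acoef d m 1) * acoef d m k = γ * omg d (1 / m) ^ k := by
    rw [conj_acoef, acoef_eq_s11, ← hc, hγ, mul_mul_mul_comm, ← omg_add, mul_assoc (c ^ 2), omg_pow,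
      ← omg_add, sq]
    congr 2
    push_cast
    field_simp
    ring
  have e3 : acoef d m (k + 1) - acoef d m 1 * acoef d m k = γ * omg d (1 / m) ^ (k + 1) := by
    have h1 : omg d ((2 * ((k + 1 : ℕ) : ℝ) - d) / (4 * m)) =
        omg d ((k + 1) / (2 * m)) * omg d (-(d / (4 * m))) :=
      expand _ _ _ (by push_cast; field_simp; ring)
    have h2 : omg d ((2 * ((1 : ℕ) : ℝ) - d) / (4 * m)) * omg d ((2 * (k : ℝ) - d) / (4 * m)) =
        omg d ((k + 1) / (2 * m)) * omg d (-(d / (4 * m))) * omg d (-(d / (4 * m))) := by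
      rw [← omg_add, ← omg_add, ← omg_add]
      congr 1
      push_cast
      field_simp
      ring
    have h3 : omg d (-((k + 1) / (2 * m))) * omg d (1 / m) ^ (k + 1) =
        omg d ((k + 1) / (2 * m)) := by
      rw [omg_pow, ← omg_add]
      congr 1
      push_cast
      field_simp
      ring
    have h4 : omg d (-(d / (4 * m))) * omg d (d / (4 * m)) = 1 := by
      rw [← omg_add, neg_add_cancel, omg_zero]
    rw [acoef_eq_s11, acoef_eq_s11, acoef_eq_s11, ← hc, hγ, h1]
    linear_combination (-c ^ 2) * h2 - c ^ 2 * h3 + omg d ((k + 1) / (2 * m)) *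
      omg d (-(d / (4 * m))) * hcc + c ^ 2 * omg d ((k + 1) / (2 * m)) * h4
  have e4 : (starRingEnd ℂ) (acoef d m (k + 1)) -
      (starRingEnd ℂ) (acoef d m 1) * (starRingEnd ℂ) (acoef d m k) = γ := by
    have h1 : omg d (-((2 * ((k + 1 : ℕ) : ℝ) - d) / (4 * m))) =
        omg d (-((k + 1) / (2 * m))) * omg d (d / (4 * m)) :=
      expand _ _ _ (by push_cast; field_simp; ring)
    have h2 : omg d (-((2 * ((1 : ℕ) : ℝ) - d) / (4 * m))) *
        omg d (-((2 * (k : ℝ) - d) / (4 * m))) =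
        omg d (-((k + 1) / (2 * m))) * omg d (d / (4 * m)) * omg d (d / (4 * m)) := by
      rw [← omg_add, ← omg_add, ← omg_add]
      congr 1
      push_cast
      field_simp
      ring
    have h4 : omg d (-(d / (4 * m))) * omg d (d / (4 * m)) = 1 := by
      rw [← omg_add, neg_add_cancel, omg_zero]
    rw [conj_acoef, conj_acoef, conj_acoef, ← hc, hγ, h1]
    linear_combination (-c ^ 2) * h2 + omg d (-((k + 1) / (2 * m))) *
      omg d (d / (4 * m)) * hcc + c ^ 2 * omg d (-((k + 1) / (2 * m))) * h4
  simp only [abar, pow_one, add_mul, mul_add, smul_mul_smul_comm, ← pow_succ', e1, e2] at h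
  ext i j
  have hij := congr_fun₂ h i j
  simp only [Matrix.add_apply, Matrix.smul_apply, smul_eq_mul, sub_mul, Matrix.sub_apply,
    smul_mul_assoc, ← pow_succ'] at hij ⊢
  apply mul_left_cancel₀ hγ0
  linear_combination hij - (B ^ (k + 1)) i j * e4 - (A ^ (k + 1)) i j * e3

theorem abar_succ {d m : ℕ} (hd : 2 ≤ d) (hm : 2 ≤ m) {A B : Matrix n n ℂ}
    (hA : A ^ d = 1) (hB : B ^ d = 1)
    (hinv : abar d m A B 1 * abar d m A B (d - 1) = 1)
    (hpow : ∀ k, 1 ≤ k → k ≤ d - 1 → abar d m A B k = abar d m A B 1 ^ k) {k : ℕ} (hk : k < d) :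
    abar d m A B (k + 1) = abar d m A B 1 * abar d m A B k := by
  rcases Nat.eq_zero_or_pos k with rfl | hk0
  · rw [abar_zero (by omega) hm, mul_one]
  · rcases Nat.lt_or_ge (k + 1) d with hlt | hge
    · rw [hpow (k + 1) (by omega) (by omega), hpow k hk0 (by omega), pow_succ']
    · obtain rfl : k = d - 1 := by omega
      rw [hinv, Nat.sub_add_cancel (by omega), abar_self (by omega) hm hA hB]

/-- Entrywise solution of the recursion `B ^ (k + 1) = p A B ^ k + p ^ k (B - p A) A ^ k` for a
diagonal matrix `A`. -/
theorem pow_apply_of_recursion {d : ℕ} {p : ℂ} {α : n → ℂ} {B : Matrix n n ℂ}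
    (h : ∀ k < d, B ^ (k + 1) = p • (diagonal α * B ^ k)
      + p ^ k • ((B - p • diagonal α) * diagonal α ^ k)) (e f : n) {k : ℕ} (hk : k ≤ d) :
    p * (B ^ k) e f = p ^ k * (B - p • diagonal α) e f *
      (∑ i ∈ Finset.range k, α e ^ i * α f ^ (k - 1 - i))
        + p ^ (k + 1) * α e ^ k * (1 : Matrix n n ℂ) e f := by
  induction k with
  | zero => simp
  | succ k ih =>
    have hG : ∑ i ∈ Finset.range (k + 1), α e ^ i * α f ^ (k + 1 - 1 - i) =
        α e * (∑ i ∈ Finset.range k, α e ^ i * α f ^ (k - 1 - i)) + α f ^ k := by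
      rw [Finset.sum_range_succ', Finset.mul_sum]
      congr 1
      · refine Finset.sum_congr rfl fun i _ => ?_
        rw [pow_succ', mul_assoc, show k + 1 - 1 - (i + 1) = k - 1 - i by omega]
      · simp
    rw [h k (by omega), hG, diagonal_pow]
    simp only [Matrix.add_apply, Matrix.smul_apply, diagonal_mul, mul_diagonal, smul_eq_mul,
      Pi.pow_apply]
    linear_combination (p * α e) * ih (by omega)

end

/-- Assuming F_{0j} = (2i/d) sin(π/m) ω^{j/2+(2−d)/(2m)} · 1_D for j ≠ ⟨0, by omega⟩, for
all k, j = 1,…,d−1: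
Σ_{i=1,i≠j}^{d−1} ((1−ω^{ki})/(1−ω^i)) ω^{i/2} F_{ij}
  = ((1−ω^{−d/m})/d) ω^{j/2+1/m} (k + ((1−ω^{kj})/(1−ω^j)) ω^j) · 1_D. -/
theorem stmt11 (d m D : ℕ) (hd : 2 ≤ d) (hm : 2 ≤ m) (hD : 1 ≤ D)
    (B : Matrix (Fin d × Fin D) (Fin d × Fin D) ℂ)
    (hB : B ∈ Matrix.unitaryGroup (Fin d × Fin D) ℂ) (hBd : B ^ d = 1)
    (F : Fin d → Fin d → Matrix (Fin D) (Fin D) ℂ)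
    (hF : ∀ (i j : Fin d) (p q : Fin D), B (i, p) (j, q) = F i j p q)
    (hrel1 : ∀ k, 1 ≤ k → k ≤ d - 1 →
      abar d m (Zmat d ⊗ₖ (1 : Matrix (Fin D) (Fin D) ℂ)) B k *
        abar d m (Zmat d ⊗ₖ (1 : Matrix (Fin D) (Fin D) ℂ)) B (d - k) = 1)
    (hrel2 : ∀ k, 1 ≤ k → k ≤ d - 1 →
      abar d m (Zmat d ⊗ₖ (1 : Matrix (Fin D) (Fin D) ℂ)) B k =
        (abar d m (Zmat d ⊗ₖ (1 : Matrix (Fin D) (Fin D) ℂ)) B 1) ^ k)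
    (hF0 : ∀ j : Fin d, j ≠ ⟨0, by omega⟩ →
      F ⟨0, by omega⟩ j = ((2 * Complex.I / d) * (Real.sin (Real.pi / m) : ℂ) *
        omg d ((j : ℝ) / 2 + (2 - (d : ℝ)) / (2 * m))) • (1 : Matrix (Fin D) (Fin D) ℂ)) :
    ∀ (k : ℕ) (j : Fin d), 1 ≤ k → k ≤ d - 1 → j ≠ ⟨0, by omega⟩ →
      ∑ i ∈ Finset.univ.filter (fun i : Fin d => i ≠ ⟨0, by omega⟩ ∧ i ≠ j),
          (((1 - omg d ((k : ℝ) * i)) / (1 - omg d (i : ℝ))) * omg d ((i : ℝ) / 2)) • F i j =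
        (((1 - omg d (-((d : ℝ) / m))) / d) * omg d ((j : ℝ) / 2 + 1 / m) *
            ((k : ℂ) + ((1 - omg d ((k : ℝ) * j)) / (1 - omg d (j : ℝ))) * omg d (j : ℝ))) •
          (1 : Matrix (Fin D) (Fin D) ℂ) := by
  intro k j hk1 hkd hj
  have hd0 : d ≠ 0 := by omega
  have hdC : (d : ℂ) ≠ 0 := by exact_mod_cast hd0
  have hm0 : (m : ℝ) ≠ 0 := by exact_mod_cast (by omega : m ≠ 0)
  set z : Fin d := ⟨0, by omega⟩ with hz
  set p := omg d (1 / m) with hp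
  have hp0 : p ≠ 0 := omg_ne_zero _ _
  set α : Fin d × Fin D → ℂ := fun e => omg d (e.1 : ℝ) with hα
  have hαd : ∀ e, α e ^ d = 1 := fun e => omg_natCast_pow_self hd0 e.1
  have hAd : (diagonal α) ^ d = 1 := by
    rw [diagonal_pow, ← diagonal_one]
    congr 1
    funext e
    exact hαd e
  rw [Zmat_kronecker_one] at hrel1 hrel2
  have hrec : ∀ k < d, B ^ (k + 1) = p • (diagonal α * B ^ k)
      + p ^ k • ((B - p • diagonal α) * diagonal α ^ k) := fun k hk =>
    pow_succ_of_abar_succ hd0 hm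
      (abar_succ hd hm hAd hBd (hrel1 1 le_rfl (by omega)) hrel2 hk)
  have hsol := fun e f k hk => pow_apply_of_recursion hrec e f (k := k) hk
  have hz0 : omg d ((z : ℕ) : ℝ) = 1 := by simp [hz, omg_zero]
  have hne : ∀ i : Fin d, i ≠ z → 1 - omg d (i : ℝ) ≠ 0 := fun i hi =>
    sub_ne_zero.mpr (omg_natCast_ne_one (fun h => hi (Fin.ext h)) i.2).symm
  have hkω : ∀ (l : ℕ) (i : Fin d), omg d ((l : ℝ) * i) = omg d (i : ℝ) ^ l := fun l i => by
    rw [omg_pow]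
  have hpd : omg d (-((d : ℝ) / m)) = (p ^ d)⁻¹ := by
    rw [hp, omg_pow, omg_neg]
    congr 2
    ring
  set K : ℂ := (2 * Complex.I / d) * (Real.sin (Real.pi / m) : ℂ) *
    omg d ((2 - (d : ℝ)) / (2 * m)) with hK
  have hK0 : K ≠ 0 := by
    have hs : (Real.sin (Real.pi / m) : ℂ) ≠ 0 := by exact_mod_cast (sin_pi_div_pos hm).ne'
    have hc : (2 * Complex.I / d : ℂ) ≠ 0 :=
      div_ne_zero (mul_ne_zero two_ne_zero Complex.I_ne_zero) hdC
    exact mul_ne_zero (mul_ne_zero hc hs) (omg_ne_zero _ _)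
  -- The diagonal blocks, from `B ^ d = 1`.
  have hdiag : ∀ (i : Fin d) (x y : Fin D), p ^ d * d * (B - p • diagonal α) (i, x) (i, y) =
      omg d (i : ℝ) * (p - p ^ (d + 1)) * (1 : Matrix (Fin D) (Fin D) ℂ) x y := by
    intro i x y
    have h := hsol (i, x) (i, y) d le_rfl
    have hS : ∑ l ∈ Finset.range d, α (i, x) ^ l * α (i, y) ^ (d - 1 - l) =
        d * omg d (i : ℝ) ^ (d - 1) := geom_sum₂_self _ _
    have hα1 : omg d (i : ℝ) * omg d (i : ℝ) ^ (d - 1) = 1 := by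
      rw [← pow_succ', Nat.sub_add_cancel (by omega)]
      exact omg_natCast_pow_self hd0 i
    have hδ : (1 : Matrix (Fin d × Fin D) (Fin d × Fin D) ℂ) (i, x) (i, y) =
        (1 : Matrix (Fin D) (Fin D) ℂ) x y := by
      simp [Matrix.one_apply]
    rw [hBd, hS, hαd, hδ] at h
    linear_combination (-omg d (i : ℝ)) * h -
      p ^ d * d * (B - p • diagonal α) (i, x) (i, y) * hα1
  -- The off-diagonal blocks of row zero.
  have hrow : ∀ (l : ℕ), l ≤ d → ∀ i : Fin d, i ≠ z → ∀ x y : Fin D,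
      p * (B ^ l) (z, x) (i, y) = p ^ l * K * (((1 - omg d ((l : ℝ) * i)) / (1 - omg d (i : ℝ))) *
        omg d ((i : ℝ) / 2)) * (1 : Matrix (Fin D) (Fin D) ℂ) x y := by
    intro l hl i hi x y
    have h := hsol (z, x) (i, y) l hl
    have hS : (∑ t ∈ Finset.range l, α (z, x) ^ t * α (i, y) ^ (l - 1 - t)) *
        (1 - omg d (i : ℝ)) = 1 - omg d (i : ℝ) ^ l := by
      have := geom_sum₂_mul (α (z, x)) (α (i, y)) l
      simpa only [hα, hz0, one_pow] using this
    have hne' : (z, x) ≠ (i, y) := fun h => hi (congrArg Prod.fst h).symm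
    have hT : (B - p • diagonal α) (z, x) (i, y) =
        K * omg d ((i : ℝ) / 2) * (1 : Matrix (Fin D) (Fin D) ℂ) x y := by
      rw [Matrix.sub_apply, Matrix.smul_apply, diagonal_apply_ne _ hne', smul_zero, sub_zero, hF,
        hF0 i hi, Matrix.smul_apply, smul_eq_mul, omg_add, hK]
      ring
    rw [Matrix.one_apply_ne hne', mul_zero, add_zero, hT, eq_div_of_mul_eq (hne i hi) hS] at h
    rw [h, hkω]
    ring
  ext x y
  set δ := (1 : Matrix (Fin D) (Fin D) ℂ) x y with hδ
  set g : Fin d → ℂ := fun i =>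
    ((1 - omg d ((k : ℝ) * i)) / (1 - omg d (i : ℝ))) * omg d ((i : ℝ) / 2) with hg
  have hzz : ∀ w, p * p ^ d * d * (B ^ k) (z, x) (z, w) =
      (p ^ k * k * (p - p ^ (d + 1)) + p ^ d * d * p ^ (k + 1)) *
        (1 : Matrix (Fin D) (Fin D) ℂ) x w := by
    intro w
    have h := hsol (z, x) (z, w) k (by omega)
    have hS : ∑ l ∈ Finset.range k, α (z, x) ^ l * α (z, w) ^ (k - 1 - l) = k := by
      simp [hα, hz0]
    have hα1 : α (z, x) = 1 := hz0
    have hδ' : (1 : Matrix (Fin d × Fin D) (Fin d × Fin D) ℂ) (z, x) (z, w) =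
        (1 : Matrix (Fin D) (Fin D) ℂ) x w := by
      simp [Matrix.one_apply]
    have h2 := hdiag z x w
    rw [hS, hα1, hδ', one_pow] at h
    rw [hz0] at h2
    linear_combination (p ^ d * d) * h + p ^ k * k * h2
  -- Row zero of `B ^ (k + 1) = B ^ k * B`.
  have hmul : p * (B ^ (k + 1)) (z, x) (j, y) =
      (∑ w, p * (B ^ k) (z, x) (z, w) * F z j w y) + p ^ k * K * (g j * F j j x y) +
        p ^ k * K * ∑ i ∈ Finset.univ.filter (fun i : Fin d => i ≠ z ∧ i ≠ j), g i * F i j x y := by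
    have hterm : ∀ i ≠ z, ∑ w, p * (B ^ k) (z, x) (i, w) * F i j w y =
        p ^ k * K * (g i * F i j x y) := by
      intro i hi
      simp only [hrow k (by omega) i hi]
      simp [Matrix.one_apply, hg, mul_assoc]
    have hfil : Finset.univ.filter (fun i : Fin d => i ≠ z ∧ i ≠ j) =
        (Finset.univ.erase z).erase j := by
      ext i
      simp [and_comm]
    rw [pow_succ, Matrix.mul_apply, Fintype.sum_prod_type, Finset.mul_sum]
    simp only [Finset.mul_sum, hF, ← mul_assoc p]
    rw [← Finset.add_sum_erase _ _ (Finset.mem_univ z),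
      ← Finset.add_sum_erase _ _ (Finset.mem_erase.mpr ⟨hj, Finset.mem_univ j⟩), hterm j hj,
      ← add_assoc, hfil]
    congr 1
    refine Finset.sum_congr rfl fun i hi => ?_
    simp only [Finset.mem_erase] at hi
    exact hterm i hi.2.1
  have hFz : ∀ w, F z j w y = K * omg d ((j : ℝ) / 2) * (1 : Matrix (Fin D) (Fin D) ℂ) w y := by
    intro w
    rw [hF0 j hj, Matrix.smul_apply, smul_eq_mul, omg_add, hK]
    ring
  have hfirst : p ^ d * d * ∑ w, p * (B ^ k) (z, x) (z, w) * F z j w y =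
      (p ^ k * k * (p - p ^ (d + 1)) + p ^ d * d * p ^ (k + 1)) *
        (K * omg d ((j : ℝ) / 2)) * δ := by
    have : ∀ w, p ^ d * d * (p * (B ^ k) (z, x) (z, w) * F z j w y) =
        (p ^ k * k * (p - p ^ (d + 1)) + p ^ d * d * p ^ (k + 1)) * (K * omg d ((j : ℝ) / 2)) *
          ((1 : Matrix (Fin D) (Fin D) ℂ) x w * (1 : Matrix (Fin D) (Fin D) ℂ) w y) := by
      intro w
      rw [hFz]
      linear_combination (K * omg d ((j : ℝ) / 2) * (1 : Matrix (Fin D) (Fin D) ℂ) w y) * hzz w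
    rw [Finset.mul_sum, Finset.sum_congr rfl fun w _ => this w, ← Finset.mul_sum,
      ← Matrix.mul_apply, one_mul]
  have hjj : p ^ d * d * F j j x y =
      omg d (j : ℝ) * (p - p ^ (d + 1) + p ^ d * d * p) * δ := by
    have h := hdiag j x y
    have hA : (diagonal α) (j, x) (j, y) = omg d (j : ℝ) * δ := by
      simp [hα, hδ, Matrix.diagonal_apply, Matrix.one_apply]
    rw [Matrix.sub_apply, Matrix.smul_apply, smul_eq_mul, hA, hF] at h
    linear_combination h
  rw [hrow (k + 1) (by omega) j hj x y, ← hδ] at hmul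
  rw [Matrix.sum_apply]
  simp only [Matrix.smul_apply, smul_eq_mul]
  rw [omg_add, ← hp, hpd, ← hδ]
  change ∑ i ∈ Finset.univ.filter (fun i : Fin d => i ≠ z ∧ i ≠ j), g i * F i j x y = _
  generalize ∑ i ∈ Finset.univ.filter (fun i : Fin d => i ≠ z ∧ i ≠ j), g i * F i j x y = S
    at hmul ⊢
  generalize ∑ w, p * (B ^ k) (z, x) (z, w) * F z j w y = R at hmul hfirst
  have hnej := hne j hj
  have hQ0 : p ^ d ≠ 0 := pow_ne_zero _ hp0
  have hk0 : p ^ k ≠ 0 := pow_ne_zero _ hp0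
  have hgj : g j = ((1 - omg d (j : ℝ) ^ k) / (1 - omg d (j : ℝ))) * omg d ((j : ℝ) / 2) := by
    rw [← hkω]
  rw [hkω] at hmul ⊢
  have hG : (1 - omg d (j : ℝ) ^ (k + 1)) / (1 - omg d (j : ℝ)) =
      1 + omg d (j : ℝ) * ((1 - omg d (j : ℝ) ^ k) / (1 - omg d (j : ℝ))) := by
    field_simp
    ring
  rw [hG, hgj] at hmul
  generalize (1 - omg d (j : ℝ) ^ k) / (1 - omg d (j : ℝ)) = G at hmul ⊢
  apply mul_left_cancel₀ (mul_ne_zero (mul_ne_zero hQ0 hdC) (mul_ne_zero hk0 hK0))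
  have hright : p ^ d * d * (p ^ k * K) * ((1 - (p ^ d)⁻¹) / d * (omg d ((j : ℝ) / 2) * p) *
      (k + G * omg d (j : ℝ)) * δ) = (p ^ d - 1) * (p ^ k * K) * (omg d ((j : ℝ) / 2) * p) *
      (k + G * omg d (j : ℝ)) * δ := by
    field_simp
  rw [hright]
  linear_combination (-(p ^ d * d)) * hmul - hfirst -
    p ^ k * K * G * omg d ((j : ℝ) / 2) * hjj
end
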